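/- Let S be a quasi-thin association scheme, F a field, x and y two vertices of S. Then the Terwilliger F-algebra of S with respect to y is isomorphic as an F-algebra to the Terwilliger F-algebra of S with respect to x. -/

import Mathlib

open scoped Classical

/-- An association scheme on a finite set `X` with `d + 1` relations. -/
structure AssocScheme (X : Type) [Fintype X] (d : ℕ) where
  /-- the relations `R_0, …, R_d` -/
  R : Fin (d + 1) → X → X → Prop
  rel_nonempty : ∀ i, ∃ x y, R i x y
  partition : ∀ x y, ∃! i, R i x y
  diag : ∀ x y, R 0 x y ↔ x = y
  /-- the transpose involution `a ↦ a'` -/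
  inv : Fin (d + 1) → Fin (d + 1)
  inv_spec : ∀ i x y, R (inv i) x y ↔ R i y x
  /-- the intersection numbers `p_{ij}^k` -/
  p : Fin (d + 1) → Fin (d + 1) → Fin (d + 1) → ℕ
  p_spec : ∀ i j k x y, R k x y → {z | R i x z ∧ R j z y}.ncard = p i j k

namespace AssocScheme

variable {X : Type} [Fintype X] [DecidableEq X] {d : ℕ}

/-- the valency `k_a = p_{a a'}^0` -/
def k (S : AssocScheme X d) (a : Fin (d + 1)) : ℕ := S.p a (S.inv a) 0

/-- `|R_a R_b|`, the number of relations in the complex product -/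
def nProd (S : AssocScheme X d) (a b : Fin (d + 1)) : ℕ :=
  (Finset.univ.filter fun c => 0 < S.p a b c).card

/-- the adjacency matrix of `R_b` over `F` -/
noncomputable def adj (S : AssocScheme X d) (F : Type) [Field F] (b : Fin (d + 1)) :
    Matrix X X F :=
  Matrix.of fun u v => if S.R b u v then 1 else 0

/-- the dual idempotent `E_a^*(x)` -/
noncomputable def dualIdem (S : AssocScheme X d) (F : Type) [Field F] (x : X)
    (a : Fin (d + 1)) : Matrix X X F :=
  Matrix.diagonal fun u => if S.R a x u then 1 else 0

/-- the Terwilliger `F`-algebra of `S` with respect to the vertex `x` -/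
noncomputable def Terw (S : AssocScheme X d) (F : Type) [Field F] (x : X) :
    Subalgebra F (Matrix X X F) :=
  Algebra.adjoin F (Set.range (S.adj F) ∪ Set.range (S.dualIdem F x))

/-- the all-ones matrix -/
def allOnes (X : Type) (F : Type) [Field F] : Matrix X X F := Matrix.of fun _ _ => 1

end AssocScheme

section FibreInvariantMatrices

variable {X I F : Type}

/-- The other point of the fibre of `col` through `u`, or `u` itself if there is none. -/
noncomputable def fibreMate (col : X → I) (u : X) : X :=
  if h : ∃ v, v ≠ u ∧ col v = col u then h.choose else u

/-- Every fibre of `col` has at most two points. -/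
def FibresAtMostTwo (col : X → I) : Prop :=
  ∀ u v w, col u = col v → col u = col w → u = v ∨ u = w ∨ v = w

/-- `M` is invariant under swapping the fibres of row and column simultaneously, and is constant on
the blocks whose pair of colours is not related by `r`. -/
def FibreInvariant (col : X → I) (r : I → I → Prop) (M : Matrix X X F) : Prop :=
  ∀ u u' v v', col u = col u' → col v = col v' →
    ((u ≠ u' ∧ v ≠ v') ∨ ¬ r (col u) (col v)) → M u v = M u' v'

theorem col_fibreMate (col : X → I) (u : X) : col (fibreMate col u) = col u := by
  unfold fibreMate
  split_ifs with h
  · exact h.choose_spec.2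
  · rfl

theorem eq_or_eq_fibreMate {col : X → I} (h2 : FibresAtMostTwo col) {u v : X}
    (h : col v = col u) : v = u ∨ v = fibreMate col u := by
  by_cases hv : v = u
  · exact Or.inl hv
  · right
    have hex : ∃ v, v ≠ u ∧ col v = col u := ⟨v, hv, h⟩
    have hs := hex.choose_spec
    have : fibreMate col u = hex.choose := by
      unfold fibreMate
      rw [dif_pos hex]
    rw [this]
    rcases h2 u v hex.choose h.symm hs.2.symm with h | h | h
    · exact absurd h.symm hv
    · exact absurd h.symm hs.1
    · exact h

theorem fibreMate_eq {col : X → I} (h2 : FibresAtMostTwo col) {u v : X}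
    (h : col v = col u) (hne : v ≠ u) : fibreMate col u = v :=
  ((eq_or_eq_fibreMate h2 h).resolve_left hne).symm

theorem fibreMate_involutive {col : X → I} (h2 : FibresAtMostTwo col) :
    Function.Involutive (fibreMate col) := by
  intro u
  by_cases h : fibreMate col u = u
  · rw [h, h]
  · exact fibreMate_eq h2 (col_fibreMate col u).symm (Ne.symm h)

variable {col : X → I} {r : I → I → Prop} {M N : Matrix X X F}

theorem FibreInvariant.apply_fibreMate (hM : FibreInvariant col r M)
    (hr : ∀ u v, r (col u) (col v) → fibreMate col u ≠ u ∧ fibreMate col v ≠ v) (u v : X) :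
    M (fibreMate col u) (fibreMate col v) = M u v := by
  refine (hM u _ v _ (col_fibreMate col u).symm (col_fibreMate col v).symm ?_).symm
  by_cases h : r (col u) (col v)
  · exact Or.inl ⟨(hr u v h).1.symm, (hr u v h).2.symm⟩
  · exact Or.inr h

variable [Field F]

theorem sum_fibre_fibreMate [Fintype X] (h2 : FibresAtMostTwo col) (c : I) (f : X → F) :
    ∑ w with col w = c, f (fibreMate col w) = ∑ w with col w = c, f w := by
  refine Finset.sum_bij' (fun w _ => fibreMate col w) (fun w _ => fibreMate col w) ?_ ?_ ?_ ?_ ?_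
  · simp [col_fibreMate]
  · simp [col_fibreMate]
  · simp [fibreMate_involutive h2 _]
  · simp [fibreMate_involutive h2 _]
  · simp

theorem FibreInvariant.mul [Fintype X] [Fintype I] (h2 : FibresAtMostTwo col)
    (hr : ∀ u v, r (col u) (col v) → fibreMate col u ≠ u ∧ fibreMate col v ≠ v)
    (htrans : ∀ a b c, r a b → r b c → r a c)
    (hM : FibreInvariant col r M) (hN : FibreInvariant col r N) :
    FibreInvariant col r (M * N) := by
  intro u u' v v' hu hv h
  simp only [Matrix.mul_apply]
  rw [← Finset.sum_fiberwise Finset.univ col (fun w => M u w * N w v),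
    ← Finset.sum_fiberwise Finset.univ col (fun w => M u' w * N w v')]
  refine Finset.sum_congr rfl fun c _ => ?_
  rcases h with ⟨hu', hv'⟩ | h
  · rw [← sum_fibre_fibreMate h2 c (fun w => M u' w * N w v')]
    refine Finset.sum_congr rfl fun w _ => ?_
    rw [← fibreMate_eq h2 hu.symm hu'.symm, ← fibreMate_eq h2 hv.symm hv'.symm,
      hM.apply_fibreMate hr, hN.apply_fibreMate hr]
  · by_cases hac : r (col u) c
    · have hcb : ¬ r c (col v) := fun h' => h (htrans _ _ _ hac h')
      have key : ∀ w, col w = c → N w v = N w v' := by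
        rintro w rfl
        exact hN w w v v' rfl hv (Or.inr hcb)
      have key' : ∀ w, col w = c → N (fibreMate col w) v = N w v := by
        rintro w rfl
        exact (hN w _ v v (col_fibreMate col w).symm rfl (Or.inr hcb)).symm
      by_cases huu : u = u'
      · subst huu
        refine Finset.sum_congr rfl fun w hw => ?_
        rw [key w (by simpa using hw)]
      · rw [← sum_fibre_fibreMate h2 c (fun w => M u' w * N w v')]
        refine Finset.sum_congr rfl fun w hw => ?_
        have hw : col w = c := by simpa using hw
        rw [← key _ ((col_fibreMate col w).trans hw), key' w hw,
          ← fibreMate_eq h2 hu.symm (Ne.symm huu), hM.apply_fibreMate hr]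
    · have key : ∀ w, col w = c → M u w = M u' w := by
        rintro w rfl
        exact hM u u' w w hu rfl (Or.inr hac)
      have key' : ∀ w, col w = c → M u' (fibreMate col w) = M u' w := by
        rintro w rfl
        exact (hM u' u' w _ rfl (col_fibreMate col w).symm (Or.inr (hu ▸ hac))).symm
      by_cases hvv : v = v'
      · subst hvv
        refine Finset.sum_congr rfl fun w hw => ?_
        rw [key w (by simpa using hw)]
      · rw [← sum_fibre_fibreMate h2 c (fun w => M u' w * N w v')]
        refine Finset.sum_congr rfl fun w hw => ?_
        have hw : col w = c := by simpa using hw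
        rw [key' w hw, ← key w hw,
          ← fibreMate_eq h2 hv.symm (Ne.symm hvv), hN.apply_fibreMate hr]

theorem FibreInvariant.add (hM : FibreInvariant col r M) (hN : FibreInvariant col r N) :
    FibreInvariant col r (M + N) := by
  intro u u' v v' hu hv h
  rw [Matrix.add_apply, Matrix.add_apply, hM u u' v v' hu hv h, hN u u' v v' hu hv h]

theorem fibreInvariant_diagonal [DecidableEq X] (h2 : FibresAtMostTwo col)
    (hrefl : ∀ u, fibreMate col u ≠ u → r (col u) (col u)) (f : I → F) :
    FibreInvariant col r (Matrix.diagonal fun u => f (col u)) := by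
  intro u u' v v' hu hv h
  simp only [Matrix.diagonal_apply]
  have huv : u = v ↔ u' = v' := by
    rcases h with ⟨hu', hv'⟩ | h
    · constructor
      · rintro rfl
        rw [← fibreMate_eq h2 hu.symm hu'.symm, ← fibreMate_eq h2 hv.symm hv'.symm]
      · rintro rfl
        rw [← fibreMate_eq h2 hu hu', ← fibreMate_eq h2 hv hv']
    · by_cases hc : col u = col v
      · have hm : fibreMate col u = u := by
          by_contra hne
          exact h (hc ▸ hrefl u hne)
        have hall : ∀ w, col w = col u → w = u := fun w hw =>
          (eq_or_eq_fibreMate h2 hw).elim id fun h' => h'.trans hm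
        rw [hall v hc.symm, hall u' hu.symm, hall v' (hv.symm.trans hc.symm)]
      · constructor
        · rintro rfl
          exact absurd rfl hc
        · rintro rfl
          exact absurd (hu.trans hv.symm) hc
  simp only [huv, hu]

end FibreInvariantMatrices

namespace AssocScheme

variable {X : Type} [Fintype X] {d : ℕ} (S : AssocScheme X d)

/-- The index of the relation containing `(x, u)`. -/
noncomputable def relIndex (x u : X) : Fin (d + 1) := (S.partition x u).choose

theorem rel_iff_relIndex_eq {x u : X} {a : Fin (d + 1)} : S.R a x u ↔ S.relIndex x u = a := by
  have h := (S.partition x u).choose_spec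
  constructor
  · intro ha
    exact (h.2 a ha).symm
  · rintro rfl
    exact h.1

theorem ncard_fibre (x : X) (a : Fin (d + 1)) : {u | S.relIndex x u = a}.ncard = S.k a := by
  rw [k, ← S.p_spec a (S.inv a) 0 x x ((S.diag x x).2 rfl)]
  congr 1
  ext u
  simp [S.inv_spec, S.rel_iff_relIndex_eq]

theorem ncard_col (x v : X) (a c : Fin (d + 1)) :
    {u | S.relIndex x u = a ∧ S.R c u v}.ncard = S.p a c (S.relIndex x v) := by
  rw [← S.p_spec a c _ x v (S.rel_iff_relIndex_eq.2 rfl)]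
  simp only [S.rel_iff_relIndex_eq]

theorem ncard_row (x u : X) (b c : Fin (d + 1)) :
    {v | S.relIndex x v = b ∧ S.R c u v}.ncard = S.p b (S.inv c) (S.relIndex x u) := by
  rw [← S.ncard_col x u b (S.inv c)]
  simp only [S.inv_spec]

/-- `R_a` and `R_b` have valency two and the block of some adjacency matrix between the two
corresponding fibres is a permutation matrix. -/
def Linked (a b : Fin (d + 1)) : Prop :=
  S.k a = 2 ∧ S.k b = 2 ∧ ∃ c, S.p a c b = 1

theorem transGen_linked_valency {a b : Fin (d + 1)} (h : Relation.TransGen S.Linked a b) :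
    S.k a = 2 ∧ S.k b = 2 := by
  induction h with
  | single h => exact ⟨h.1, h.2.1⟩
  | tail _ h ih => exact ⟨ih.1, h.2.1⟩

theorem fibresAtMostTwo_relIndex (hqt : ∀ a, S.k a ≤ 2) (x : X) :
    FibresAtMostTwo (S.relIndex x) := by
  intro u v w huv huw
  by_contra! hne
  have hsub : ({u, v, w} : Set X) ⊆ {z | S.relIndex x z = S.relIndex x u} := by
    rintro z (rfl | rfl | rfl)
    exacts [rfl, huv.symm, huw.symm]
  have h3 : ({u, v, w} : Set X).ncard = 3 := by
    rw [Set.ncard_eq_three]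
    exact ⟨u, v, w, hne.1, hne.2.1, hne.2.2, rfl⟩
  have := Set.ncard_le_ncard hsub (Set.toFinite _)
  rw [h3, S.ncard_fibre] at this
  have := hqt (S.relIndex x u)
  omega

theorem ncard_fibre_inter {X I : Type} {col : X → I} (h2 : FibresAtMostTwo col) {u : X}
    (hu : fibreMate col u ≠ u) (Q : X → Prop) :
    {z | col z = col u ∧ Q z}.ncard =
      (if Q u then 1 else 0) + (if Q (fibreMate col u) then 1 else 0) := by
  have key : {z | col z = col u ∧ Q z} = {z | (z = u ∨ z = fibreMate col u) ∧ Q z} := by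
    ext z
    refine and_congr_left fun _ => ⟨eq_or_eq_fibreMate h2, ?_⟩
    rintro (rfl | rfl)
    exacts [rfl, col_fibreMate col u]
  rw [key]
  split_ifs with hQ hQ' hQ'
  · rw [Set.ncard_eq_two]
    refine ⟨u, fibreMate col u, hu.symm, ?_⟩
    ext z
    simp only [Set.mem_ofPred_eq, Set.mem_insert_iff, Set.mem_singleton_iff]
    grind
  · rw [Set.ncard_eq_one]
    refine ⟨u, ?_⟩
    ext z
    simp only [Set.mem_ofPred_eq, Set.mem_singleton_iff]
    grind
  · rw [zero_add, Set.ncard_eq_one]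
    refine ⟨fibreMate col u, ?_⟩
    ext z
    simp only [Set.mem_ofPred_eq, Set.mem_singleton_iff]
    grind
  · rw [zero_add, Set.ncard_eq_zero (Set.Finite.subset (Set.toFinite {u, fibreMate col u})
      fun z hz => hz.1)]
    ext z
    simp only [Set.mem_ofPred_eq, Set.mem_empty_iff_false]
    grind

theorem ncard_fibre_inter_of_fibreMate_eq {X I : Type} {col : X → I} (h2 : FibresAtMostTwo col)
    {u : X} (hu : fibreMate col u = u) (Q : X → Prop) :
    {z | col z = col u ∧ Q z}.ncard = if Q u then 1 else 0 := by
  have key : {z | col z = col u ∧ Q z} = {z | z = u ∧ Q z} := by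
    ext z
    refine and_congr_left fun _ => ⟨fun h => ?_, congrArg col⟩
    exact (eq_or_eq_fibreMate h2 h).elim id fun h' => h'.trans hu
  rw [key]
  split_ifs with hQ
  · rw [Set.ncard_eq_one]
    refine ⟨u, ?_⟩
    ext z
    simp only [Set.mem_ofPred_eq, Set.mem_singleton_iff]
    grind
  · convert Set.ncard_empty X
    ext z
    simp only [Set.mem_ofPred_eq, Set.mem_empty_iff_false]
    grind

theorem fibreMate_ne_iff (hqt : ∀ a, S.k a ≤ 2) (x u : X) :
    fibreMate (S.relIndex x) u ≠ u ↔ S.k (S.relIndex x u) = 2 := by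
  have h2 := S.fibresAtMostTwo_relIndex hqt x
  rw [← S.ncard_fibre x]
  constructor
  · intro h
    simpa using ncard_fibre_inter h2 h (fun _ => True)
  · intro h hu
    have : {z | S.relIndex x z = S.relIndex x u} = {u} := by
      ext z
      refine ⟨fun hz => (eq_or_eq_fibreMate h2 hz).elim id fun h' => h'.trans hu, ?_⟩
      rintro rfl
      rfl
    rw [this, Set.ncard_singleton] at h
    omega

theorem fibreMate_ne_of_transGen_linked (hqt : ∀ a, S.k a ≤ 2) (x u v : X)
    (h : Relation.TransGen S.Linked (S.relIndex x u) (S.relIndex x v)) :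
    fibreMate (S.relIndex x) u ≠ u ∧ fibreMate (S.relIndex x) v ≠ v := by
  rw [S.fibreMate_ne_iff hqt, S.fibreMate_ne_iff hqt]
  exact S.transGen_linked_valency h

theorem linked_self (x u : X) (h : S.k (S.relIndex x u) = 2) :
    S.Linked (S.relIndex x u) (S.relIndex x u) := by
  refine ⟨h, h, 0, ?_⟩
  rw [← S.ncard_col x u, Set.ncard_eq_one]
  refine ⟨u, ?_⟩
  ext z
  simp only [S.diag, Set.mem_ofPred_eq, Set.mem_singleton_iff]
  exact ⟨fun h => h.2, by rintro rfl; exact ⟨rfl, rfl⟩⟩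

/-- On a block of two two-point fibres, each relation is invariant under the simultaneous swap. -/
theorem rel_fibreMate_fibreMate (hqt : ∀ a, S.k a ≤ 2) (x : X) (c : Fin (d + 1)) {u v : X}
    (hu : fibreMate (S.relIndex x) u ≠ u) (hv : fibreMate (S.relIndex x) v ≠ v) :
    (S.R c (fibreMate (S.relIndex x) u) (fibreMate (S.relIndex x) v) ↔ S.R c u v) ∧
    (S.R c (fibreMate (S.relIndex x) u) v ↔ S.R c u (fibreMate (S.relIndex x) v)) := by
  have h2 := S.fibresAtMostTwo_relIndex hqt x
  have c1 := S.ncard_col x v (S.relIndex x u) c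
  have c2 := S.ncard_col x (fibreMate (S.relIndex x) v) (S.relIndex x u) c
  have r1 := S.ncard_row x u (S.relIndex x v) c
  have r2 := S.ncard_row x (fibreMate (S.relIndex x) u) (S.relIndex x v) c
  rw [ncard_fibre_inter h2 hu] at c1 c2
  rw [ncard_fibre_inter h2 hv] at r1 r2
  rw [col_fibreMate (S.relIndex x)] at c2 r2
  split_ifs at c1 c2 r1 r2 <;> simp_all <;> omega

/-- On a block of two fibres that are not linked, each relation is constant. -/
theorem rel_fibreMate_of_not_linked (hqt : ∀ a, S.k a ≤ 2) (x : X) (c : Fin (d + 1)) {u v : X}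
    (h : ¬ S.Linked (S.relIndex x u) (S.relIndex x v)) :
    (S.R c u (fibreMate (S.relIndex x) v) ↔ S.R c u v) ∧
    (S.R c (fibreMate (S.relIndex x) u) v ↔ S.R c u v) := by
  have h2 := S.fibresAtMostTwo_relIndex hqt x
  have c1 := S.ncard_col x v (S.relIndex x u) c
  have c2 := S.ncard_col x (fibreMate (S.relIndex x) v) (S.relIndex x u) c
  have r1 := S.ncard_row x u (S.relIndex x v) c
  have r2 := S.ncard_row x (fibreMate (S.relIndex x) u) (S.relIndex x v) c
  rw [col_fibreMate (S.relIndex x)] at c2 r2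
  by_cases hu : fibreMate (S.relIndex x) u = u
  · rw [ncard_fibre_inter_of_fibreMate_eq h2 hu] at c1 c2
    rw [hu]
    split_ifs at c1 c2 <;> simp_all <;> omega
  by_cases hv : fibreMate (S.relIndex x) v = v
  · rw [ncard_fibre_inter_of_fibreMate_eq h2 hv] at r1 r2
    rw [hv]
    split_ifs at r1 r2 <;> simp_all <;> omega
  have hp : S.p (S.relIndex x u) c (S.relIndex x v) ≠ 1 := fun hp =>
    h ⟨(S.fibreMate_ne_iff hqt x u).1 hu, (S.fibreMate_ne_iff hqt x v).1 hv, c, hp⟩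
  rw [ncard_fibre_inter h2 hu] at c1 c2
  split_ifs at c1 c2 <;> simp_all <;> omega

theorem fibreInvariant_adj (hqt : ∀ a, S.k a ≤ 2) (F : Type) [Field F] (x : X)
    (c : Fin (d + 1)) :
    FibreInvariant (S.relIndex x) (Relation.TransGen S.Linked) (S.adj F c) := by
  have h2 := S.fibresAtMostTwo_relIndex hqt x
  intro u u' v v' hu hv h
  suffices S.R c u' v' ↔ S.R c u v by simp [adj, this]
  rcases h with ⟨huu, hvv⟩ | h
  · rw [← fibreMate_eq h2 hu.symm huu.symm, ← fibreMate_eq h2 hv.symm hvv.symm]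
    refine (S.rel_fibreMate_fibreMate hqt x c ?_ ?_).1
    · rwa [fibreMate_eq h2 hu.symm huu.symm, ne_comm]
    · rwa [fibreMate_eq h2 hv.symm hvv.symm, ne_comm]
  · have hrow : ∀ v', S.relIndex x v = S.relIndex x v' → (S.R c u' v' ↔ S.R c u v') := by
      intro w hw
      have hl : ¬ S.Linked (S.relIndex x u) (S.relIndex x w) := fun hl =>
        h (hw ▸ Relation.TransGen.single hl)
      rcases eq_or_eq_fibreMate h2 hu.symm with rfl | rfl
      · rfl
      · exact (S.rel_fibreMate_of_not_linked hqt x c hl).2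
    rw [hrow v' hv]
    rcases eq_or_eq_fibreMate h2 hv.symm with rfl | rfl
    · rfl
    · exact (S.rel_fibreMate_of_not_linked hqt x c
        fun hl => h (Relation.TransGen.single hl)).1

theorem exists_relIndex_eq (x : X) {a : Fin (d + 1)} (ha : S.k a = 2) :
    ∃ u, S.relIndex x u = a := by
  rw [← S.ncard_fibre x] at ha
  exact Set.nonempty_of_ncard_ne_zero (ha ▸ two_ne_zero)

/-- The fibres with respect to two vertices can be matched by a permutation of `X`. -/
theorem exists_perm_relIndex_eq (x y : X) :
    ∃ σ : X ≃ X, ∀ u, S.relIndex x (σ u) = S.relIndex y u := by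
  have h : ∀ a, Nonempty ({u // S.relIndex y u = a} ≃ {u // S.relIndex x u = a}) := fun a =>
    Finite.card_eq.1 ((S.ncard_fibre y a).trans (S.ncard_fibre x a).symm)
  exact ⟨Equiv.ofFiberEquiv fun a => (h a).some, Equiv.ofFiberEquiv_map _⟩

variable (F : Type) [Field F]

/-- The block of `M` between the fibres of colours `a` and `b`. -/
noncomputable def fibreBlock (x : X) (a b : Fin (d + 1)) (M : Matrix X X F) : Matrix X X F :=
  Matrix.of fun u v => if S.relIndex x u = a ∧ S.relIndex x v = b then M u v else 0

theorem sum_fibreBlock (x : X) (M : Matrix X X F) :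
    ∑ a, ∑ b, S.fibreBlock F x a b M = M := by
  ext u v
  simp [fibreBlock, Matrix.sum_apply, ite_and]

variable [DecidableEq X]

theorem dualIdem_eq (x : X) (a : Fin (d + 1)) :
    S.dualIdem F x a = Matrix.diagonal fun u => if S.relIndex x u = a then 1 else 0 := by
  simp only [dualIdem, S.rel_iff_relIndex_eq]

theorem fibreInvariant_of_mem_terw (hqt : ∀ a, S.k a ≤ 2) {x : X} {M : Matrix X X F}
    (hM : M ∈ S.Terw F x) :
    FibreInvariant (S.relIndex x) (Relation.TransGen S.Linked) M := by
  have h2 := S.fibresAtMostTwo_relIndex hqt x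
  have hrefl : ∀ u, fibreMate (S.relIndex x) u ≠ u →
      Relation.TransGen S.Linked (S.relIndex x u) (S.relIndex x u) := fun u hu =>
    Relation.TransGen.single (S.linked_self x u ((S.fibreMate_ne_iff hqt x u).1 hu))
  induction hM using Algebra.adjoin_induction with
  | mem M hM =>
    rcases hM with ⟨c, rfl⟩ | ⟨a, rfl⟩
    · exact S.fibreInvariant_adj hqt F x c
    · rw [S.dualIdem_eq]
      exact fibreInvariant_diagonal h2 hrefl fun b => if b = a then 1 else 0
  | algebraMap t => exact fibreInvariant_diagonal h2 hrefl fun _ => t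
  | add M N _ _ hM hN => exact hM.add hN
  | mul M N _ _ hM hN =>
    exact hM.mul h2 (S.fibreMate_ne_of_transGen_linked hqt x)
      (fun _ _ _ => Relation.TransGen.trans) hN

theorem fibreBlock_eq (x : X) (a b : Fin (d + 1)) (M : Matrix X X F) :
    S.fibreBlock F x a b M = S.dualIdem F x a * M * S.dualIdem F x b := by
  ext u v
  rw [dualIdem_eq, dualIdem_eq, Matrix.mul_diagonal, Matrix.diagonal_mul, fibreBlock,
    Matrix.of_apply, ite_and]
  split_ifs <;> simp

theorem fibreBlock_mem_terw {x : X} (a b : Fin (d + 1)) {M : Matrix X X F}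
    (hM : M ∈ S.Terw F x) : S.fibreBlock F x a b M ∈ S.Terw F x := by
  rw [fibreBlock_eq]
  exact mul_mem (mul_mem (Algebra.subset_adjoin (Or.inr ⟨a, rfl⟩)) hM)
    (Algebra.subset_adjoin (Or.inr ⟨b, rfl⟩))

theorem adj_mem_terw (x : X) (c : Fin (d + 1)) : S.adj F c ∈ S.Terw F x :=
  Algebra.subset_adjoin (Or.inl ⟨c, rfl⟩)

theorem allOnes_mem_terw (x : X) : allOnes X F ∈ S.Terw F x := by
  have : allOnes X F = ∑ c, S.adj F c := by
    ext u v
    simp [allOnes, adj, Matrix.sum_apply, S.rel_iff_relIndex_eq]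
  rw [this]
  exact sum_mem fun c _ => S.adj_mem_terw F x c

/-- The sum of the matrix units at `(u, v)` and at the pair of their fibre mates. -/
noncomputable def mateUnit (x u v : X) : Matrix X X F :=
  Matrix.single u v 1 +
    Matrix.single (fibreMate (S.relIndex x) u) (fibreMate (S.relIndex x) v) 1

theorem mateUnit_mul {x u v w : X} (hw : fibreMate (S.relIndex x) w ≠ w) :
    S.mateUnit F x u w * S.mateUnit F x w v = S.mateUnit F x u v := by
  simp [mateUnit, add_mul, mul_add, Matrix.single_mul_single_of_ne, hw, hw.symm]

/-- A matrix block invariant under the simultaneous swap is a combination of two `mateUnit`s. -/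
theorem fibreBlock_eq_mateUnit (hqt : ∀ a, S.k a ≤ 2) {x u v : X} {M : Matrix X X F}
    (hu : fibreMate (S.relIndex x) u ≠ u) (hv : fibreMate (S.relIndex x) v ≠ v)
    (h₁ : M (fibreMate (S.relIndex x) u) (fibreMate (S.relIndex x) v) = M u v)
    (h₂ : M (fibreMate (S.relIndex x) u) v = M u (fibreMate (S.relIndex x) v)) :
    S.fibreBlock F x (S.relIndex x u) (S.relIndex x v) M =
      M u v • S.mateUnit F x u v +
        M u (fibreMate (S.relIndex x) v) • S.mateUnit F x u (fibreMate (S.relIndex x) v) := by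
  have h2 := S.fibresAtMostTwo_relIndex hqt x
  ext s t
  simp only [fibreBlock, mateUnit, Matrix.of_apply, Matrix.add_apply, Matrix.smul_apply,
    Matrix.single_apply, fibreMate_involutive h2 v, smul_eq_mul]
  by_cases hs : S.relIndex x s = S.relIndex x u
  · by_cases ht : S.relIndex x t = S.relIndex x v
    · rcases eq_or_eq_fibreMate h2 hs with rfl | rfl <;>
      rcases eq_or_eq_fibreMate h2 ht with rfl | rfl <;>
      simp [hu, hv, hu.symm, hv.symm, col_fibreMate, h₁, h₂]
    · have h3 : v ≠ t := by rintro rfl; exact ht rfl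
      have h4 : fibreMate (S.relIndex x) v ≠ t := by rintro rfl; exact ht (col_fibreMate _ _)
      simp [ht, h3, h4]
  · have h3 : u ≠ s := by rintro rfl; exact hs rfl
    have h4 : fibreMate (S.relIndex x) u ≠ s := by rintro rfl; exact hs (col_fibreMate _ _)
    simp [hs, h3, h4]

theorem mateUnit_mem_terw_of_linked (hqt : ∀ a, S.k a ≤ 2) {x u v : X}
    (h : S.Linked (S.relIndex x u) (S.relIndex x v)) : S.mateUnit F x u v ∈ S.Terw F x := by
  have h2 := S.fibresAtMostTwo_relIndex hqt x
  obtain ⟨hu, hv⟩ := S.fibreMate_ne_of_transGen_linked hqt x u v (Relation.TransGen.single h)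
  obtain ⟨-, -, c, hc⟩ := h
  rw [← S.ncard_col x v, ncard_fibre_inter h2 hu] at hc
  obtain ⟨h₁, h₂⟩ := S.rel_fibreMate_fibreMate hqt x c hu hv
  have hA := S.fibreBlock_mem_terw F (S.relIndex x u) (S.relIndex x v) (S.adj_mem_terw F x c)
  have hJ := S.fibreBlock_mem_terw F (S.relIndex x u) (S.relIndex x v) (S.allOnes_mem_terw F x)
  rw [S.fibreBlock_eq_mateUnit F hqt hu hv (by simp [adj, h₁]) (by simp [adj, h₂])] at hA
  rw [S.fibreBlock_eq_mateUnit F hqt hu hv rfl rfl] at hJ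
  by_cases huv : S.R c u v
  · have hn : ¬ S.R c u (fibreMate (S.relIndex x) v) := by
      rw [← h₂]
      intro h'
      simp [huv, h'] at hc
    simpa [adj, huv, hn] using hA
  · have hn : S.R c u (fibreMate (S.relIndex x) v) := by
      rw [← h₂]
      by_contra h'
      simp [huv, h'] at hc
    have hA' : S.mateUnit F x u (fibreMate (S.relIndex x) v) ∈ S.Terw F x := by
      simpa [adj, huv, hn] using hA
    simpa [allOnes] using sub_mem hJ hA'

theorem mateUnit_mem_terw (hqt : ∀ a, S.k a ≤ 2) {x u : X} {b : Fin (d + 1)}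
    (h : Relation.TransGen S.Linked (S.relIndex x u) b) :
    ∀ v, S.relIndex x v = b → S.mateUnit F x u v ∈ S.Terw F x := by
  induction h with
  | single h =>
    rintro v rfl
    exact S.mateUnit_mem_terw_of_linked F hqt h
  | tail _ h ih =>
    rintro v rfl
    obtain ⟨w, rfl⟩ := S.exists_relIndex_eq x h.1
    rw [← S.mateUnit_mul F ((S.fibreMate_ne_iff hqt x w).2 h.1)]
    exact mul_mem (ih w rfl) (S.mateUnit_mem_terw_of_linked F hqt h)

/-- The Terwilliger algebra of a quasi-thin scheme consists of the fibre-invariant matrices. -/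
theorem mem_terw_iff (hqt : ∀ a, S.k a ≤ 2) {x : X} {M : Matrix X X F} :
    M ∈ S.Terw F x ↔ FibreInvariant (S.relIndex x) (Relation.TransGen S.Linked) M := by
  refine ⟨S.fibreInvariant_of_mem_terw F hqt, fun hM => ?_⟩
  rw [← S.sum_fibreBlock F x M]
  refine sum_mem fun a _ => sum_mem fun b _ => ?_
  by_cases hab : Relation.TransGen S.Linked a b
  · obtain ⟨u, rfl⟩ := S.exists_relIndex_eq x (S.transGen_linked_valency hab).1
    obtain ⟨v, rfl⟩ := S.exists_relIndex_eq x (S.transGen_linked_valency hab).2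
    have hr := S.fibreMate_ne_of_transGen_linked hqt x
    have h₂ := hM.apply_fibreMate hr u (fibreMate (S.relIndex x) v)
    rw [fibreMate_involutive (S.fibresAtMostTwo_relIndex hqt x) v] at h₂
    rw [S.fibreBlock_eq_mateUnit F hqt (hr u v hab).1 (hr u v hab).2
      (hM.apply_fibreMate hr u v) h₂]
    exact add_mem (Subalgebra.smul_mem _ (S.mateUnit_mem_terw F hqt hab _ rfl) _)
      (Subalgebra.smul_mem _ (S.mateUnit_mem_terw F hqt hab _ (col_fibreMate _ _)) _)
  · obtain ⟨m, hm⟩ : ∃ m, ∀ u v, S.relIndex x u = a → S.relIndex x v = b → M u v = m := by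
      by_cases hne : ∃ u v, S.relIndex x u = a ∧ S.relIndex x v = b
      · obtain ⟨u, v, rfl, rfl⟩ := hne
        exact ⟨M u v, fun s t hs ht => (hM u s v t hs.symm ht.symm (Or.inr hab)).symm⟩
      · exact ⟨0, fun u v hu hv => absurd ⟨u, v, hu, hv⟩ hne⟩
    have : S.fibreBlock F x a b M = m • S.fibreBlock F x a b (allOnes X F) := by
      ext u v
      simp only [fibreBlock, allOnes, Matrix.of_apply, Matrix.smul_apply, smul_eq_mul]
      split_ifs with h
      · rw [hm u v h.1 h.2, mul_one]
      · rw [mul_zero]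
    rw [this]
    exact Subalgebra.smul_mem _ (S.fibreBlock_mem_terw F a b (S.allOnes_mem_terw F x)) _

end AssocScheme

open AssocScheme

/-- for a quasi-thin scheme, the Terwilliger algebras with respect to any two
vertices are isomorphic as `F`-algebras. -/
theorem stmt_18 {X : Type} [Fintype X] [DecidableEq X] {d : ℕ} (S : AssocScheme X d)
    (F : Type) [Field F] (x y : X) (hqt : ∀ a, S.k a ≤ 2) :
    Nonempty ((S.Terw F y) ≃ₐ[F] (S.Terw F x)) := by
  obtain ⟨σ, hσ⟩ := S.exists_perm_relIndex_eq x y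
  let e : Matrix X X F ≃ₐ[F] Matrix X X F := Matrix.reindexAlgEquiv F F σ
  refine ⟨(e.subalgebraMap (S.Terw F y)).trans (Subalgebra.equivOfEq _ _ ?_)⟩
  ext M
  rw [S.mem_terw_iff F hqt, Subalgebra.mem_map]
  constructor
  · rintro ⟨N, hN, rfl⟩ u u' v v' hu hv h
    rw [S.mem_terw_iff F hqt] at hN
    have hσ' : ∀ w, S.relIndex y (σ.symm w) = S.relIndex x w := fun w => by
      rw [← hσ, σ.apply_symm_apply]
    refine hN (σ.symm u) (σ.symm u') (σ.symm v) (σ.symm v') ?_ ?_ ?_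
    · rw [hσ', hσ', hu]
    · rw [hσ', hσ', hv]
    · simpa [hσ'] using h
  · intro hM
    refine ⟨e.symm M, ?_, e.apply_symm_apply M⟩
    rw [S.mem_terw_iff F hqt]
    intro u u' v v' hu hv h
    refine hM (σ u) (σ u') (σ v) (σ v') ?_ ?_ ?_
    · rw [hσ, hσ, hu]
    · rw [hσ, hσ, hv]
    · simpa [hσ] using h
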